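/- Assume m ≥ 2, let M be a nonempty set of pairs (i,j) with 1 ≤ i < j ≤ m, fix β̃_{ij} ∈ Δ_m supported on coordinates {i,j} for each (i,j) ∈ M, and fix R ∈ ℝ. Define l(x) = inf over β ∈ Δ_m of (⟨β, x⟩ − I'_concave(β)). Then for every x ∈ ℝ^m, l(x) = min( min over (i,j) ∈ M of (⟨β̃_{ij}, x⟩ − R), inf over β ∈ Δ_m of (⟨β, x⟩ − I(β)) ). -/

import Mathlib

/-- A probability mass function on a finite type. -/
def IsPMF {X : Type*} [Fintype X] (q : X → ℝ) : Prop :=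
  (∀ x, 0 ≤ q x) ∧ ∑ x, q x = 1

/-- KL divergence between pmfs on a finite type (convention `0 · log 0 = 0`). -/
noncomputable def KL {X : Type*} [Fintype X] (q p : X → ℝ) : ℝ :=
  ∑ x, q x * Real.log (q x / p x)

/-- `J_a(β) = −log Σ_x Π_i ν^i_a(x)^{β_i}`. -/
noncomputable def Jfun {X : Type*} [Fintype X] {K m : ℕ} (ν : Fin m → Fin K → X → ℝ)
    (a : Fin K) (β : Fin m → ℝ) : ℝ :=
  -Real.log (∑ x, ∏ i, ν i a x ^ β i)

/-- `I(β) = min_a J_a(β)`. -/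
noncomputable def Ifun {X : Type*} [Fintype X] {K m : ℕ} (ν : Fin m → Fin K → X → ℝ)
    (β : Fin m → ℝ) : ℝ :=
  ⨅ a : Fin K, Jfun ν a β

/-- `L(β) = max_a J_a(β)`. -/
noncomputable def Lfun {X : Type*} [Fintype X] {K m : ℕ} (ν : Fin m → Fin K → X → ℝ)
    (β : Fin m → ℝ) : ℝ :=
  ⨆ a : Fin K, Jfun ν a β

/-- The perturbed upper concave envelope `I'_concave(β)` determined by `R`, the set of
perturbed pairs `M` and the perturbation points `β̃`. -/
noncomputable def Iconc {X : Type*} [Fintype X] {K m : ℕ} (ν : Fin m → Fin K → X → ℝ)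
    (R : ℝ) (M : Finset (Fin m × Fin m)) (βt : Fin m × Fin m → Fin m → ℝ)
    (β : Fin m → ℝ) : ℝ :=
  sSup {r : ℝ | ∃ (lam : {p // p ∈ M} → ℝ) (lb : ℝ) (β' : Fin m → ℝ),
    (∀ p, 0 ≤ lam p) ∧ 0 ≤ lb ∧ (∑ p, lam p) + lb = 1 ∧
    β' ∈ stdSimplex ℝ (Fin m) ∧
    β = (fun k => (∑ p : {p // p ∈ M}, lam p * βt p.1 k) + lb * β' k) ∧
    r = R * (∑ p, lam p) + lb * Ifun ν β'}

/-- The set of values whose supremum is `Iconc`. -/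
def concValues {X : Type*} [Fintype X] {K m : ℕ} (ν : Fin m → Fin K → X → ℝ)
    (R : ℝ) (M : Finset (Fin m × Fin m)) (βt : Fin m × Fin m → Fin m → ℝ)
    (β : Fin m → ℝ) : Set ℝ :=
  {r : ℝ | ∃ (lam : {p // p ∈ M} → ℝ) (lb : ℝ) (β' : Fin m → ℝ),
    (∀ p, 0 ≤ lam p) ∧ 0 ≤ lb ∧ (∑ p, lam p) + lb = 1 ∧
    β' ∈ stdSimplex ℝ (Fin m) ∧
    β = (fun k => (∑ p : {p // p ∈ M}, lam p * βt p.1 k) + lb * β' k) ∧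
    r = R * (∑ p, lam p) + lb * Ifun ν β'}

section

variable {X : Type*} [Fintype X] {K m : ℕ} {ν : Fin m → Fin K → X → ℝ}

theorem continuous_Jfun [Nonempty X] (hfull : ∀ i a x, 0 < ν i a x) (a : Fin K) :
    Continuous (Jfun ν a) := by
  have hpos : ∀ β : Fin m → ℝ, 0 < ∑ x, ∏ i, ν i a x ^ β i := fun β =>
    Finset.sum_pos (fun x _ => Finset.prod_pos fun i _ => Real.rpow_pos_of_pos (hfull i a x) _)
      Finset.univ_nonempty
  refine (Continuous.log ?_ fun β => (hpos β).ne').neg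
  refine continuous_finsetSum _ fun x _ => continuous_finsetProd _ fun i _ => ?_
  exact continuous_const.rpow (continuous_apply i) fun β => Or.inl (hfull i a x).ne'

theorem bddBelow_range_sub_Ifun [Nonempty X] (hK : 1 ≤ K) (hfull : ∀ i a x, 0 < ν i a x)
    (x : Fin m → ℝ) :
    BddBelow (Set.range fun β : stdSimplex ℝ (Fin m) =>
      ∑ k, (β : Fin m → ℝ) k * x k - Ifun ν β) := by
  have hcont : Continuous fun β : Fin m → ℝ => ∑ k, β k * x k - Jfun ν ⟨0, hK⟩ β :=
    (by fun_prop : Continuous fun β : Fin m → ℝ => ∑ k, β k * x k).sub (continuous_Jfun hfull _)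
  obtain ⟨c, hc⟩ := (isCompact_stdSimplex ℝ (Fin m)).bddBelow_image hcont.continuousOn
  refine ⟨c, ?_⟩
  rintro _ ⟨β, rfl⟩
  have hle : Ifun ν β ≤ Jfun ν ⟨0, hK⟩ β := ciInf_le (Set.finite_range _).bddBelow _
  exact (hc ⟨β, β.2, rfl⟩).trans (sub_le_sub_left hle _)

variable {R : ℝ} {M : Finset (Fin m × Fin m)} {βt : Fin m × Fin m → Fin m → ℝ}

theorem le_sub_of_mem_concValues {x β : Fin m → ℝ} {v r : ℝ}
    (hM : ∀ p : {p // p ∈ M}, v ≤ ∑ k, βt p.1 k * x k - R)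
    (hI : ∀ β' ∈ stdSimplex ℝ (Fin m), v ≤ ∑ k, β' k * x k - Ifun ν β')
    (hr : r ∈ concValues ν R M βt β) : r ≤ ∑ k, β k * x k - v := by
  obtain ⟨lam, lb, β', hlam, hlb, hsum, hβ', rfl, rfl⟩ := hr
  have hinner : ∑ k, ((∑ p : {p // p ∈ M}, lam p * βt p.1 k) + lb * β' k) * x k =
      ∑ p, lam p * ∑ k, βt p.1 k * x k + lb * ∑ k, β' k * x k := by
    simp only [add_mul, Finset.sum_add_distrib, Finset.sum_mul, Finset.mul_sum, mul_assoc]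
    rw [Finset.sum_comm]
  have hpairs : ∑ p, lam p * (v + R) ≤ ∑ p, lam p * ∑ k, βt p.1 k * x k :=
    Finset.sum_le_sum fun p _ => mul_le_mul_of_nonneg_left (by linarith [hM p]) (hlam p)
  rw [← Finset.sum_mul] at hpairs
  have hbase := mul_le_mul_of_nonneg_left (hI β' hβ') hlb
  have hv : v = (∑ p, lam p) * v + lb * v := by rw [← add_mul, hsum, one_mul]
  rw [hinner]
  linarith

theorem Ifun_mem_concValues {β : Fin m → ℝ} (hβ : β ∈ stdSimplex ℝ (Fin m)) :
    Ifun ν β ∈ concValues ν R M βt β :=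
  ⟨0, 1, β, by simp, by simp, by simp, hβ, by simp, by simp⟩

theorem mem_concValues_of_mem {p : Fin m × Fin m} (hp : p ∈ M)
    (hβ : βt p ∈ stdSimplex ℝ (Fin m)) : R ∈ concValues ν R M βt (βt p) := by
  classical
  refine ⟨Pi.single ⟨p, hp⟩ 1, 0, βt p, fun q => ?_, le_rfl, by simp, hβ, ?_, by simp⟩
  · exact (Pi.single_nonneg.2 zero_le_one : (0 : {p // p ∈ M} → ℝ) ≤ _) q
  · ext k
    simp [Pi.single_apply]

end

/-- **Lemma 12 of the paper (tractable representation of `l`).**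
With `l(x) = inf_{β ∈ Δ_m} (⟨β,x⟩ − I'_concave(β))`, for every `x`:
`l(x) = min( min_{(i,j) ∈ M} (⟨β̃_{ij}, x⟩ − R), inf_{β ∈ Δ_m} (⟨β,x⟩ − I(β)) )`. -/
theorem stmt_17 {X : Type*} [Fintype X] [Nonempty X] (K m : ℕ) (hK : 1 ≤ K) (hm : 2 ≤ m)
    (ν : Fin m → Fin K → X → ℝ) (hν : ∀ i a, IsPMF (ν i a))
    (hfull : ∀ i a x, 0 < ν i a x)
    (M : Finset (Fin m × Fin m)) (hMne : M.Nonempty) (hMlt : ∀ p ∈ M, p.1 < p.2)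
    (βt : Fin m × Fin m → Fin m → ℝ)
    (hβt : ∀ p ∈ M, βt p ∈ stdSimplex ℝ (Fin m) ∧
      ∀ k, k ≠ p.1 → k ≠ p.2 → βt p k = 0)
    (R : ℝ)
    (l : (Fin m → ℝ) → ℝ)
    (hl : ∀ x, l x = ⨅ β : stdSimplex ℝ (Fin m),
      (∑ k, (β : Fin m → ℝ) k * x k - Iconc ν R M βt β)) :
    ∀ x : Fin m → ℝ,
      l x = min (⨅ p : {p // p ∈ M}, (∑ k, βt p.1 k * x k - R))
        (⨅ β : stdSimplex ℝ (Fin m), (∑ k, (β : Fin m → ℝ) k * x k - Ifun ν β)) := by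
  intro x
  rw [hl x]
  have : Nonempty {p // p ∈ M} := hMne.to_subtype
  have : Nonempty (stdSimplex ℝ (Fin m)) := hMne.elim fun p hp => ⟨⟨βt p, (hβt p hp).1⟩⟩
  set v := min (⨅ p : {p // p ∈ M}, (∑ k, βt p.1 k * x k - R))
    (⨅ β : stdSimplex ℝ (Fin m), (∑ k, (β : Fin m → ℝ) k * x k - Ifun ν β))
  have hM : ∀ p : {p // p ∈ M}, v ≤ ∑ k, βt p.1 k * x k - R := fun p =>
    (min_le_left _ _).trans (ciInf_le (Set.finite_range _).bddBelow p)
  have hI : ∀ β ∈ stdSimplex ℝ (Fin m), v ≤ ∑ k, β k * x k - Ifun ν β := fun β hβ =>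
    (min_le_right _ _).trans (ciInf_le (bddBelow_range_sub_Ifun hK hfull x) ⟨β, hβ⟩)
  have hbdd : ∀ β, BddAbove (concValues ν R M βt β) := fun β =>
    ⟨_, fun _ hr => le_sub_of_mem_concValues hM hI hr⟩
  have hlower : ∀ β : stdSimplex ℝ (Fin m),
      v ≤ ∑ k, (β : Fin m → ℝ) k * x k - Iconc ν R M βt β := fun β =>
    le_sub_comm.1 (csSup_le ⟨_, Ifun_mem_concValues β.2⟩
      fun _ hr => le_sub_of_mem_concValues hM hI hr)
  have hupper : ∀ β ∈ stdSimplex ℝ (Fin m), ∀ r ∈ concValues ν R M βt β,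
      (⨅ β : stdSimplex ℝ (Fin m), (∑ k, (β : Fin m → ℝ) k * x k - Iconc ν R M βt β)) ≤
        ∑ k, β k * x k - r := fun β hβ r hr =>
    (ciInf_le ⟨v, Set.forall_mem_range.2 hlower⟩ ⟨β, hβ⟩).trans
      (sub_le_sub_left (le_csSup (hbdd β) hr) _)
  refine le_antisymm (le_min (le_ciInf fun p => ?_) (le_ciInf fun β => ?_)) (le_ciInf hlower)
  · exact hupper _ (hβt p p.2).1 _ (mem_concValues_of_mem p.2 (hβt p p.2).1)
  · exact hupper β β.2 _ (Ifun_mem_concValues β.2)
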